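/- arXiv:2303.03228 — 3 statements merged into one kernel-verified Lean document; each statement's English description precedes it below -/
import Mathlib

section
/- Let U ⊆ ℝ² be open, X : U → ℝ³ a smooth map, N : U → ℝ³ a smooth map with ‖N(u)‖ = 1, ⟨∂ᵢX(u), N(u)⟩ = 0 for i = 1,2, and ⟨∂ᵢN(u), ∂ⱼN(u)⟩ = λ(u)·δᵢⱼ for a function λ : U → ℝ with λ > 0. Set h(u) = ⟨X(u), N(u)⟩. Then for every u ∈ U: ∂ⱼh(u) = ⟨X(u), ∂ⱼN(u)⟩ for j = 1,2, and X(u) = (∂₁h(u)·∂₁N(u) + ∂₂h(u)·∂₂N(u))/λ(u) + h(u)·N(u). -/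
noncomputable section

open scoped RealInnerProductSpace

/-- The coordinate directions of `ℝ²`. -/
def dir2 : Fin 2 → ℝ × ℝ := ![(1, 0), (0, 1)]

/-- If `card ι = finrank ℝ E`, a vector orthogonal to all members of an orthogonal family of nonzero
vectors indexed by `ι` vanishes. -/
theorem eq_zero_of_inner_eq_zero_of_pairwise_orthogonal {ι E : Type*} [Fintype ι]
    [NormedAddCommGroup E] [InnerProductSpace ℝ E] [FiniteDimensional ℝ E]
    {v : ι → E} (hv : ∀ i, v i ≠ 0) (horth : Pairwise fun i j => ⟪v i, v j⟫ = 0)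
    (hcard : Fintype.card ι = Module.finrank ℝ E) {w : E} (hw : ∀ i, ⟪v i, w⟫ = 0) : w = 0 := by
  have hspan : Submodule.span ℝ (Set.range v) = ⊤ :=
    (linearIndependent_of_ne_zero_of_inner_eq_zero hv horth).span_eq_top_of_card_eq_finrank' hcard
  have hmem : w ∈ (Submodule.span ℝ (Set.range v))ᗮ := by
    rw [Submodule.mem_orthogonal]
    intro x hx
    induction hx using Submodule.span_induction with
    | mem x hx => obtain ⟨i, rfl⟩ := hx; exact hw i
    | zero => exact inner_zero_left w
    | add x y _ _ hx hy => rw [inner_add_left, hx, hy, add_zero]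
    | smul a x _ hx => rw [real_inner_smul_left, hx, mul_zero]
  simpa [hspan] using hmem

/-- Expansion of a vector of `ℝ³` in an orthogonal frame `a, b, n` with `‖a‖² = ‖b‖² = l` and
`‖n‖ = 1`. -/
theorem eq_orthogonal_frame_expansion {a b n : EuclideanSpace ℝ (Fin 3)} {l : ℝ} (hl : l ≠ 0)
    (haa : ⟪a, a⟫ = l) (hbb : ⟪b, b⟫ = l) (hnn : ⟪n, n⟫ = 1)
    (hab : ⟪a, b⟫ = 0) (han : ⟪a, n⟫ = 0) (hbn : ⟪b, n⟫ = 0) (x : EuclideanSpace ℝ (Fin 3)) :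
    x = l⁻¹ • (⟪x, a⟫ • a + ⟪x, b⟫ • b) + ⟪x, n⟫ • n := by
  have hba : ⟪b, a⟫ = 0 := by rw [real_inner_comm, hab]
  have hna : ⟪n, a⟫ = 0 := by rw [real_inner_comm, han]
  have hnb : ⟪n, b⟫ = 0 := by rw [real_inner_comm, hbn]
  rw [← sub_eq_zero]
  refine eq_zero_of_inner_eq_zero_of_pairwise_orthogonal (v := ![a, b, n]) ?_ ?_ (by simp) ?_
  · intro i hi
    fin_cases i
    · exact hl (by rw [← haa, show a = 0 from hi, inner_zero_left])
    · exact hl (by rw [← hbb, show b = 0 from hi, inner_zero_left])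
    · exact one_ne_zero (by rw [← hnn, show n = 0 from hi, inner_zero_left])
  · intro i j hij
    fin_cases i <;> fin_cases j <;> simp_all
  · intro i
    fin_cases i <;>
      simp only [Fin.zero_eta, Fin.mk_one, Fin.reduceFinMk, Matrix.cons_val, inner_sub_right,
        inner_add_right, real_inner_smul_right, haa, hbb, hnn, hab, han, hbn, hba, hna, hnb]
    · rw [real_inner_comm]; field_simp; ring
    · rw [real_inner_comm]; field_simp; ring
    · rw [real_inner_comm]; ring

/-- Let `U ⊆ ℝ²` be open, `X : U → ℝ³` smooth, `N : U → ℝ³` a smooth unit-vector field with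
`⟨∂ᵢX, N⟩ = 0` and `⟨∂ᵢN, ∂ⱼN⟩ = λ·δᵢⱼ` for some `λ > 0`, and let `h = ⟨X, N⟩` be the
support function. Then `∂ⱼh = ⟨X, ∂ⱼN⟩` and `X = (∂₁h·∂₁N + ∂₂h·∂₂N)/λ + h·N` on `U`. -/
theorem stmt8 (U : Set (ℝ × ℝ)) (hU : IsOpen U)
    (X N : ℝ × ℝ → EuclideanSpace ℝ (Fin 3))
    (hX : ContDiffOn ℝ (⊤ : ℕ∞) X U) (hN : ContDiffOn ℝ (⊤ : ℕ∞) N U)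
    (hNorm : ∀ u ∈ U, ‖N u‖ = 1)
    (htan : ∀ u ∈ U, ∀ i : Fin 2, ⟪fderiv ℝ X u (dir2 i), N u⟫ = 0)
    (lam : ℝ × ℝ → ℝ) (hlam : ∀ u ∈ U, 0 < lam u)
    (hconf : ∀ u ∈ U, ∀ i j : Fin 2,
      ⟪fderiv ℝ N u (dir2 i), fderiv ℝ N u (dir2 j)⟫
        = lam u * (if i = j then 1 else 0))
    (h : ℝ × ℝ → ℝ) (hh : ∀ u, h u = ⟪X u, N u⟫) :
    ∀ u ∈ U,
      (∀ j : Fin 2, fderiv ℝ h u (dir2 j) = ⟪X u, fderiv ℝ N u (dir2 j)⟫) ∧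
      X u = (lam u)⁻¹ •
          (fderiv ℝ h u (dir2 0) • fderiv ℝ N u (dir2 0)
            + fderiv ℝ h u (dir2 1) • fderiv ℝ N u (dir2 1))
        + h u • N u := by
  intro u hu
  have hUu : U ∈ nhds u := hU.mem_nhds hu
  have hXd : DifferentiableAt ℝ X u := (hX.contDiffAt hUu).differentiableAt (by simp)
  have hNd : DifferentiableAt ℝ N u := (hN.contDiffAt hUu).differentiableAt (by simp)
  have hdN : ∀ j : Fin 2, ⟪fderiv ℝ N u (dir2 j), N u⟫ = 0 := by
    intro j
    have hconst : (fun y => ⟪N y, N y⟫) =ᶠ[nhds u] fun _ => (1 : ℝ) := by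
      filter_upwards [hUu] with y hy
      rw [real_inner_self_eq_norm_sq, hNorm y hy, one_pow]
    have hder := fderiv_inner_apply ℝ hNd hNd (dir2 j)
    rw [hconst.fderiv_eq, real_inner_comm] at hder
    simp only [fderiv_fun_const, Pi.zero_apply, zero_apply] at hder
    linarith
  have hdh : ∀ j : Fin 2, fderiv ℝ h u (dir2 j) = ⟪X u, fderiv ℝ N u (dir2 j)⟫ := by
    intro j
    rw [funext hh, fderiv_inner_apply ℝ hXd hNd, htan u hu j, add_zero]
  refine ⟨hdh, ?_⟩
  rw [hdh 0, hdh 1, hh u]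
  exact eq_orthogonal_frame_expansion (hlam u hu).ne' (by simpa using hconf u hu 0 0)
    (by simpa using hconf u hu 1 1) (by rw [real_inner_self_eq_norm_sq, hNorm u hu, one_pow])
    (by simpa using hconf u hu 0 1) (hdN 0) (hdN 1) (X u)
end
end

section
/- Let U ⊆ ℝ² be open, X : U → ℝ³ a smooth map, N : U → ℝ³ a smooth map with ‖N(u)‖ = 1, ⟨∂ᵢX(u), N(u)⟩ = 0 for i = 1,2, and ⟨∂ᵢN(u), ∂ⱼN(u)⟩ = λ(u)·δᵢⱼ with λ > 0, and set h = ⟨X, N⟩. Then the quadratic distance function Λ(u) = ⟨X(u), X(u)⟩ satisfies Λ = ((∂₁h)² + (∂₂h)²)/λ + h² at every point of U. -/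
noncomputable section

open scoped RealInnerProductSpace

/-- Parseval's identity in dimension three, for an orthogonal frame `a`, `b`, `n` with
`‖a‖² = ‖b‖² = l` and `‖n‖ = 1`. -/
theorem inner_self_eq_of_orthogonal_frame {E : Type*} [NormedAddCommGroup E]
    [InnerProductSpace ℝ E] (hE : Module.finrank ℝ E = 3) {a b n : E} {l : ℝ} (hl : 0 < l)
    (haa : ⟪a, a⟫ = l) (hbb : ⟪b, b⟫ = l) (hab : ⟪a, b⟫ = 0) (hn : ‖n‖ = 1)
    (han : ⟪a, n⟫ = 0) (hbn : ⟪b, n⟫ = 0) (x : E) :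
    ⟪x, x⟫ = (⟪x, a⟫ ^ 2 + ⟪x, b⟫ ^ 2) / l + ⟪x, n⟫ ^ 2 := by
  have : FiniteDimensional ℝ E := Module.finite_of_finrank_pos (by omega)
  have hs : √l * √l = l := Real.mul_self_sqrt hl.le
  have hs0 : √l ≠ 0 := (Real.sqrt_pos.2 hl).ne'
  have hunit : (√l)⁻¹ * ((√l)⁻¹ * l) = 1 := by
    field_simp
    rw [sq, hs]
  have hnn : ⟪n, n⟫ = 1 := by rw [real_inner_self_eq_norm_sq, hn, one_pow]
  have hba : ⟪b, a⟫ = 0 := by rw [real_inner_comm, hab]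
  have hna : ⟪n, a⟫ = 0 := by rw [real_inner_comm, han]
  have hnb : ⟪n, b⟫ = 0 := by rw [real_inner_comm, hbn]
  have hv : Orthonormal ℝ ![(√l)⁻¹ • a, (√l)⁻¹ • b, n] := by
    rw [orthonormal_iff_ite]
    intro i j
    fin_cases i <;> fin_cases j <;>
      simp [-inner_self_eq_norm_sq_to_K, real_inner_smul_left, real_inner_smul_right,
        haa, hbb, hab, hnn, han, hbn, hba, hna, hnb, hunit]
  have hspan : ⊤ ≤ Submodule.span ℝ (Set.range ![(√l)⁻¹ • a, (√l)⁻¹ • b, n]) :=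
    (hv.linearIndependent.span_eq_top_of_card_eq_finrank' (by simp [hE])).ge
  have hP := (OrthonormalBasis.mk hv hspan).sum_sq_norm_inner_left x
  simp only [OrthonormalBasis.coe_mk, Fin.sum_univ_three, Real.norm_eq_abs, sq_abs] at hP
  simp only [Matrix.cons_val, real_inner_smul_right, mul_pow, inv_pow, Real.sq_sqrt hl.le] at hP
  rw [real_inner_self_eq_norm_sq, ← hP]
  ring

/-- A vector field of constant norm is orthogonal to its derivatives. -/
theorem inner_fderiv_eq_zero_of_norm_eqOn {F E : Type*} [NormedAddCommGroup F] [NormedSpace ℝ F]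
    [NormedAddCommGroup E] [InnerProductSpace ℝ E] {N : F → E} {U : Set F} {u : F} {r : ℝ}
    (hU : U ∈ nhds u) (hN : DifferentiableAt ℝ N u) (hr : ∀ w ∈ U, ‖N w‖ = r) (v : F) :
    ⟪fderiv ℝ N u v, N u⟫ = 0 := by
  have hconst : (fun w => ⟪N w, N w⟫) =ᶠ[nhds u] fun _ => r ^ 2 := by
    filter_upwards [hU] with w hw
    rw [real_inner_self_eq_norm_sq, hr w hw]
  have hd := fderiv_inner_apply ℝ hN hN v
  rw [hconst.fderiv_eq, real_inner_comm (fderiv ℝ N u v) (N u)] at hd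
  simp only [fderiv_fun_const, Pi.zero_apply, zero_apply] at hd
  linarith

/-- Let `U ⊆ ℝ²` be open, `X : U → ℝ³` smooth, `N : U → ℝ³` a smooth unit-vector field with
`⟨∂ᵢX, N⟩ = 0` and `⟨∂ᵢN, ∂ⱼN⟩ = λ·δᵢⱼ` for some `λ > 0`, and let `h = ⟨X, N⟩`. Then the
quadratic distance function `Λ = ⟨X, X⟩` satisfies `Λ = ((∂₁h)² + (∂₂h)²)/λ + h²` on `U`. -/
theorem stmt9 (U : Set (ℝ × ℝ)) (hU : IsOpen U)
    (X N : ℝ × ℝ → EuclideanSpace ℝ (Fin 3))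
    (hX : ContDiffOn ℝ (⊤ : ℕ∞) X U) (hN : ContDiffOn ℝ (⊤ : ℕ∞) N U)
    (hNorm : ∀ u ∈ U, ‖N u‖ = 1)
    (htan : ∀ u ∈ U, ∀ i : Fin 2, ⟪fderiv ℝ X u (dir2 i), N u⟫ = 0)
    (lam : ℝ × ℝ → ℝ) (hlam : ∀ u ∈ U, 0 < lam u)
    (hconf : ∀ u ∈ U, ∀ i j : Fin 2,
      ⟪fderiv ℝ N u (dir2 i), fderiv ℝ N u (dir2 j)⟫
        = lam u * (if i = j then 1 else 0))
    (h : ℝ × ℝ → ℝ) (hh : ∀ u, h u = ⟪X u, N u⟫)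
    (Λ : ℝ × ℝ → ℝ) (hΛ : ∀ u, Λ u = ⟪X u, X u⟫) :
    ∀ u ∈ U,
      Λ u = ((fderiv ℝ h u (dir2 0)) ^ 2 + (fderiv ℝ h u (dir2 1)) ^ 2) / lam u
        + (h u) ^ 2 := by
  intro u hu
  have hUu := hU.mem_nhds hu
  have hdX : DifferentiableAt ℝ X u := (hX.contDiffAt hUu).differentiableAt (by simp)
  have hdN : DifferentiableAt ℝ N u := (hN.contDiffAt hUu).differentiableAt (by simp)
  have hdh : ∀ i, fderiv ℝ h u (dir2 i) = ⟪X u, fderiv ℝ N u (dir2 i)⟫ := fun i => by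
    rw [funext hh, fderiv_inner_apply ℝ hdX hdN, htan u hu i, add_zero]
  have hNo := inner_fderiv_eq_zero_of_norm_eqOn hUu hdN hNorm
  rw [hΛ, hh, hdh, hdh]
  exact inner_self_eq_of_orthogonal_frame (by simp) (hlam u hu)
    (by simpa using hconf u hu 0 0) (by simpa using hconf u hu 1 1)
    (by simpa using hconf u hu 0 1) (hNorm u hu) (hNo _) (hNo _) (X u)
end
end

section
/- For a, b ∈ ℝ define X_{a,b} : ℝ² → ℝ³ by X_{a,b}(u₁, u₂) = (e^{a u₁ + b}/(1 + e^{2u₁}))·(M(u₁)·cos u₂, M(u₁)·sin u₂, P(u₁)), where M(u₁) = (a·(e^{−u₁} − e^{3u₁}) + 4·e^{u₁})/2 and P(u₁) = 1 − e^{2u₁} − a·(1 + e^{2u₁}). If a = 0, then ‖X_{0,b}(u₁, u₂)‖ = e^{b} for all (u₁, u₂) ∈ ℝ², and X_{0,b} is an immersion (its partial derivatives ∂₁X_{0,b} and ∂₂X_{0,b} are linearly independent at every point); hence the only regular rotational surface in this family with a = 0 is the sphere of radius e^{b} centered at the origin. -/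
noncomputable section

/-- `M(u₁) = (a(e^{−u₁} − e^{3u₁}) + 4e^{u₁})/2`. -/
def Mrot (a : ℝ) (u₁ : ℝ) : ℝ :=
  (a * (Real.exp (-u₁) - Real.exp (3 * u₁)) + 4 * Real.exp u₁) / 2

/-- `P(u₁) = 1 − e^{2u₁} − a(1 + e^{2u₁})`. -/
def Prot (a : ℝ) (u₁ : ℝ) : ℝ :=
  1 - Real.exp (2 * u₁) - a * (1 + Real.exp (2 * u₁))

/-- The rotational RT-surfaces
`X_{a,b}(u₁,u₂) = (e^{a u₁ + b}/(1+e^{2u₁}))·(M(u₁) cos u₂, M(u₁) sin u₂, P(u₁)) : ℝ² → ℝ³`. -/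
def Xab (a b : ℝ) (u : ℝ × ℝ) : EuclideanSpace ℝ (Fin 3) :=
  (WithLp.equiv 2 (Fin 3 → ℝ)).symm
    ![Real.exp (a * u.1 + b) / (1 + Real.exp (2 * u.1)) * (Mrot a u.1 * Real.cos u.2),
      Real.exp (a * u.1 + b) / (1 + Real.exp (2 * u.1)) * (Mrot a u.1 * Real.sin u.2),
      Real.exp (a * u.1 + b) / (1 + Real.exp (2 * u.1)) * Prot a u.1]

/-- The surface of revolution with profile curve `(r, z)`. -/
def surfaceOfRevolution (r z : ℝ → ℝ) (u : ℝ × ℝ) : EuclideanSpace ℝ (Fin 3) :=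
  !₂[r u.1 * Real.cos u.2, r u.1 * Real.sin u.2, z u.1]

theorem hasFDerivAt_surfaceOfRevolution {r z : ℝ → ℝ} {r' z' : ℝ} {u : ℝ × ℝ}
    (hr : HasDerivAt r r' u.1) (hz : HasDerivAt z z' u.1) :
    HasFDerivAt (surfaceOfRevolution r z)
      ((ContinuousLinearMap.fst ℝ ℝ ℝ).smulRight
          !₂[r' * Real.cos u.2, r' * Real.sin u.2, z'] +
        (ContinuousLinearMap.snd ℝ ℝ ℝ).smulRight
          !₂[-(r u.1 * Real.sin u.2), r u.1 * Real.cos u.2, 0]) u := by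
  have hr' := hr.comp_hasFDerivAt u (hasFDerivAt_fst (𝕜 := ℝ) (E := ℝ) (F := ℝ) (p := u))
  have hz' := hz.comp_hasFDerivAt u (hasFDerivAt_fst (𝕜 := ℝ) (E := ℝ) (F := ℝ) (p := u))
  have hc := (Real.hasDerivAt_cos u.2).comp_hasFDerivAt u (hasFDerivAt_snd (𝕜 := ℝ) (E := ℝ) (F := ℝ) (p := u))
  have hs := (Real.hasDerivAt_sin u.2).comp_hasFDerivAt u (hasFDerivAt_snd (𝕜 := ℝ) (E := ℝ) (F := ℝ) (p := u))
  rw [← hasFDerivWithinAt_univ, hasFDerivWithinAt_euclidean]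
  intro i
  rw [hasFDerivWithinAt_univ]
  fin_cases i
  · refine (hr'.mul hc).congr_fderiv ?_
    ext <;> simp [mul_comm]
  · refine (hr'.mul hs).congr_fderiv ?_
    ext <;> simp [mul_comm]
  · refine hz'.congr_fderiv ?_
    ext <;> simp

theorem linearIndependent_fderiv_surfaceOfRevolution {r z : ℝ → ℝ} {r' z' : ℝ} {u : ℝ × ℝ}
    (hr : HasDerivAt r r' u.1) (hz : HasDerivAt z z' u.1) (hr0 : r u.1 ≠ 0) (hz0 : z' ≠ 0) :
    LinearIndependent ℝ
      ![fderiv ℝ (surfaceOfRevolution r z) u (1, 0),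
        fderiv ℝ (surfaceOfRevolution r z) u (0, 1)] := by
  rw [(hasFDerivAt_surfaceOfRevolution hr hz).fderiv, LinearIndependent.pair_iff]
  intro s t h
  have h0 := congrArg (fun v : EuclideanSpace ℝ (Fin 3) => v 0) h
  have h1 := congrArg (fun v : EuclideanSpace ℝ (Fin 3) => v 1) h
  have h2 := congrArg (fun v : EuclideanSpace ℝ (Fin 3) => v 2) h
  simp [hz0] at h0 h1 h2
  subst h2
  refine ⟨rfl, ?_⟩
  simp [hr0] at h0 h1
  by_contra ht
  have hs := h0.resolve_left ht
  have hc := h1.resolve_left ht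
  simpa [hs, hc] using Real.sin_sq_add_cos_sq u.2

theorem Xab_zero (b : ℝ) :
    Xab 0 b = surfaceOfRevolution
      (fun t => Real.exp b * (2 * Real.exp t / (1 + Real.exp (2 * t))))
      (fun t => Real.exp b * ((1 - Real.exp (2 * t)) / (1 + Real.exp (2 * t)))) := by
  funext u
  ext i
  fin_cases i <;> simp [Xab, surfaceOfRevolution, Mrot, Prot] <;> ring

theorem norm_Xab_zero (b : ℝ) (u : ℝ × ℝ) : ‖Xab 0 b u‖ = Real.exp b := by
  rw [Xab_zero, EuclideanSpace.norm_eq, Real.sqrt_eq_iff_eq_sq (by positivity) (by positivity)]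
  have hE : Real.exp (2 * u.1) = Real.exp u.1 ^ 2 := by
    rw [← Real.exp_nat_mul]; norm_num
  have h : (1 + Real.exp u.1 ^ 2) ≠ 0 := by positivity
  simp only [surfaceOfRevolution, Fin.sum_univ_three, Real.norm_eq_abs, sq_abs, hE,
    Matrix.cons_val]
  field_simp
  linear_combination 4 * Real.exp u.1 ^ 2 * Real.sin_sq_add_cos_sq u.2

theorem linearIndependent_fderiv_Xab_zero (b : ℝ) (u : ℝ × ℝ) :
    LinearIndependent ℝ
      ![fderiv ℝ (Xab 0 b) u (1, 0), fderiv ℝ (Xab 0 b) u (0, 1)] := by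
  have hpos : 1 + Real.exp (2 * u.1) ≠ 0 := by positivity
  have hexp : HasDerivAt (fun t : ℝ => Real.exp (2 * t)) (Real.exp (2 * u.1) * (2 * 1)) u.1 :=
    ((hasDerivAt_id u.1).const_mul 2).exp
  have hr := ((((Real.hasDerivAt_exp u.1).const_mul 2).div (hexp.const_add 1) hpos).const_mul
    (Real.exp b))
  have hz := (((hexp.const_sub 1).div (hexp.const_add 1) hpos).const_mul (Real.exp b))
  rw [Xab_zero]
  refine linearIndependent_fderiv_surfaceOfRevolution hr hz (by positivity) ?_
  refine mul_ne_zero (Real.exp_ne_zero b) (div_ne_zero ?_ (pow_ne_zero 2 hpos))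
  have := Real.exp_pos (2 * u.1)
  nlinarith

/-- If `a = 0` then `‖X_{0,b}‖ ≡ e^b` and `X_{0,b}` is an immersion (its partial
derivatives are linearly independent at every point): the only regular rotational surface
in the family with `a = 0` is the sphere of radius `e^b` centered at the origin. -/
theorem stmt18 (b : ℝ) :
    (∀ u : ℝ × ℝ, ‖Xab 0 b u‖ = Real.exp b) ∧
    (∀ u : ℝ × ℝ,
      LinearIndependent ℝ
        ![fderiv ℝ (Xab 0 b) u (1, 0), fderiv ℝ (Xab 0 b) u (0, 1)]) := by
  exact ⟨norm_Xab_zero b, linearIndependent_fderiv_Xab_zero b⟩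
end
end
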